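/- Let P be a standard parabolic submonoid of M satisfying Assumption 1, and let b ∈ P and g ∈ M be such that b^g is defined (with b^g ∈ M). Assume that for some integer i > 0, Δ_P left-divides bⁱ. Then the P-tail T_P(g) is a P-ribbon. -/

import Mathlib

/-!
Common setting: Garside monoids, standard parabolic submonoids, heads,
ribbons, following Digne–Michel, "Ribbons in Garside monoids".
-/

namespace GarsidePaper

variable {M : Type*}

/-- `a` left-divides `b` : `b = a * c` for some `c`. -/
def LDvd [Monoid M] (a b : M) : Prop := ∃ c, b = a * c

/-- `a` right-divides `b` : `b = c * a` for some `c`. -/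
def RDvd [Monoid M] (a b : M) : Prop := ∃ c, b = c * a

/-- `a` is a factor of `b` : `a` left-divides a right-divisor of `b`. -/
def IsFactor [Monoid M] (a b : M) : Prop := ∃ c, LDvd a c ∧ RDvd c b

/-- A Garside structure on a (left- and right-) cancellative monoid `M`:
left/right gcds and lcms, Noetherianity, and a Garside element `Δ`. -/
structure GarsideStruct (M : Type*) [CancelMonoid M] where
  /-- left-gcd : gcd for the left-divisibility order -/
  lgcd : M → M → M
  lgcd_dvd_left : ∀ a b, LDvd (lgcd a b) a
  lgcd_dvd_right : ∀ a b, LDvd (lgcd a b) b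
  lgcd_greatest : ∀ a b d, LDvd d a → LDvd d b → LDvd d (lgcd a b)
  /-- right-lcm : lcm for the left-divisibility order -/
  rlcm : M → M → M
  ldvd_rlcm_left : ∀ a b, LDvd a (rlcm a b)
  ldvd_rlcm_right : ∀ a b, LDvd b (rlcm a b)
  rlcm_least : ∀ a b m, LDvd a m → LDvd b m → LDvd (rlcm a b) m
  /-- right-gcd : gcd for the right-divisibility order -/
  rgcd : M → M → M
  rgcd_dvd_left : ∀ a b, RDvd (rgcd a b) a
  rgcd_dvd_right : ∀ a b, RDvd (rgcd a b) b
  rgcd_greatest : ∀ a b d, RDvd d a → RDvd d b → RDvd d (rgcd a b)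
  /-- left-lcm : lcm for the right-divisibility order -/
  llcm : M → M → M
  rdvd_llcm_left : ∀ a b, RDvd a (llcm a b)
  rdvd_llcm_right : ∀ a b, RDvd b (llcm a b)
  llcm_least : ∀ a b m, RDvd a m → RDvd b m → RDvd (llcm a b) m
  /-- Noetherian: no infinite sequence where each term is a proper factor
  of the previous one. -/
  noetherian : WellFounded (fun a b : M => IsFactor a b ∧ a ≠ b)
  /-- the Garside element -/
  Δ : M
  /-- the left- and right-divisors of `Δ` coincide -/
  delta_balanced : ∀ a : M, LDvd a Δ ↔ RDvd a Δ
  /-- the divisors of `Δ` generate `M` -/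
  delta_generates : Submonoid.closure {a : M | LDvd a Δ} = ⊤

variable [CancelMonoid M]

/-- An atom: an element with no proper nontrivial divisor (factor). -/
def IsAtom' (a : M) : Prop := a ≠ 1 ∧ ∀ b : M, IsFactor b a → b = 1 ∨ b = a

/-- A standard parabolic submonoid: a submonoid closed under factors in which
every element of `M` has a maximal left-divisor (the left `P`-head) and a
maximal right-divisor (the right `P`-head) lying in `P`. -/
structure IsStdParabolic (P : Submonoid M) : Prop where
  factor_closed : ∀ a b : M, b ∈ P → IsFactor a b → a ∈ P
  exists_left_head : ∀ g : M, ∃ h, h ∈ P ∧ LDvd h g ∧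
    ∀ h', h' ∈ P → LDvd h' g → LDvd h' h
  exists_right_head : ∀ g : M, ∃ h, h ∈ P ∧ RDvd h g ∧
    ∀ h', h' ∈ P → RDvd h' g → RDvd h' h

/-- `h` is the left `P`-head `H_P g` of `g` : the maximal left-divisor of `g`
lying in `P`. -/
def IsLeftHead (P : Set M) (g h : M) : Prop :=
  h ∈ P ∧ LDvd h g ∧ ∀ h', h' ∈ P → LDvd h' g → LDvd h' h

/-- `h` is the right `P`-head of `g` : the maximal right-divisor of `g`
lying in `P`. -/
def IsRightHead (P : Set M) (g h : M) : Prop :=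
  h ∈ P ∧ RDvd h g ∧ ∀ h', h' ∈ P → RDvd h' g → RDvd h' h

/-- `g` is `P`-reduced : `H_P g = 1`, i.e. the only left-divisor of `g`
lying in `P` is `1`. -/
def PReduced (P : Set M) (g : M) : Prop := ∀ h ∈ P, LDvd h g → h = 1

/-- `P ^ g` is defined: `p ^ g` is defined (`g ≼ p * g`) for every `p ∈ P`. -/
def ConjSetDef (P : Set M) (g : M) : Prop := ∀ p ∈ P, LDvd g (p * g)

/-- The set `P ^ g = { p ^ g : p ∈ P }`, where `p ^ g` is the unique `c`
with `p * g = g * c`. -/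
def conjSet (P : Set M) (g : M) : Set M := {c : M | ∃ p ∈ P, p * g = g * c}

/-- A `P`-ribbon: a `P`-reduced element `g` such that `P ^ g` is defined. -/
def IsRibbon (P : Set M) (g : M) : Prop := PReduced P g ∧ ConjSetDef P g

/-- `P` is the smallest standard parabolic submonoid containing `S₁`. -/
def IsSmallestParabolicContaining (S₁ : Set M) (P : Submonoid M) : Prop :=
  IsStdParabolic P ∧ S₁ ⊆ (P : Set M) ∧
    ∀ Q : Submonoid M, IsStdParabolic Q → S₁ ⊆ (Q : Set M) → P ≤ Q

/-- Assumption 1: for any set `S₁` of atoms, the right-lcm of `S₁` is the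
Garside element `Δ_{P₁} = H_{P₁}(Δ)` of the smallest standard parabolic
submonoid `P₁` containing `S₁`. -/
def Assumption1 (G : GarsideStruct M) : Prop :=
  ∀ S₁ : Set M, (∀ s ∈ S₁, IsAtom' s) →
    ∀ P₁ : Submonoid M, IsSmallestParabolicContaining S₁ P₁ →
      ∀ d : M, IsLeftHead (P₁ : Set M) G.Δ d →
        (∀ s ∈ S₁, LDvd s d) ∧ ∀ m : M, (∀ s ∈ S₁, LDvd s m) → LDvd d m

/-- Assumption 2: some (positive) power of `Δ` is central. -/
def Assumption2 (G : GarsideStruct M) : Prop :=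
  ∃ n : ℕ, 0 < n ∧ ∀ x : M, G.Δ ^ n * x = x * G.Δ ^ n

/-- `v = v_{s,P}` : the element defined by `Δ_{P_s} = Δ_P * v`, where `P_s`
is the smallest standard parabolic submonoid containing `P` and `s`. -/
def IsVsp (G : GarsideStruct M) (P : Submonoid M) (s v : M) : Prop :=
  ∃ Ps : Submonoid M, IsSmallestParabolicContaining ((P : Set M) ∪ {s}) Ps ∧
    ∃ dP dPs : M, IsLeftHead (P : Set M) G.Δ dP ∧
      IsLeftHead (Ps : Set M) G.Δ dPs ∧ dPs = dP * v

lemma IsFactor.of_mul_mul (a b c : M) : IsFactor b (a * b * c) :=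
  ⟨b * c, ⟨c, rfl⟩, a, mul_assoc a b c⟩

lemma IsFactor.exists_eq {a b : M} (h : IsFactor a b) : ∃ c d, b = c * a * d := by
  obtain ⟨c, ⟨d, rfl⟩, e, rfl⟩ := h
  exact ⟨e, d, (mul_assoc _ _ _).symm⟩

lemma IsFactor.trans {a b c : M} (hab : IsFactor a b) (hbc : IsFactor b c) :
    IsFactor a c := by
  obtain ⟨u, v, rfl⟩ := hab.exists_eq
  obtain ⟨w, x, rfl⟩ := hbc.exists_eq
  have : w * (u * a * v) * x = (w * u) * a * (v * x) := by simp only [mul_assoc]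
  rw [this]
  exact IsFactor.of_mul_mul _ _ _

lemma LDvd.isFactor {a b : M} (h : LDvd a b) : IsFactor a b :=
  ⟨b, h, 1, (one_mul b).symm⟩

lemma RDvd.isFactor {a b : M} (h : RDvd a b) : IsFactor a b :=
  ⟨a, ⟨1, (mul_one a).symm⟩, h⟩

lemma LDvd.trans {a b c : M} (hab : LDvd a b) (hbc : LDvd b c) : LDvd a c := by
  obtain ⟨u, rfl⟩ := hab
  obtain ⟨v, rfl⟩ := hbc
  exact ⟨u * v, mul_assoc _ _ _⟩

lemma RDvd.trans {a b c : M} (hab : RDvd a b) (hbc : RDvd b c) : RDvd a c := by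
  obtain ⟨u, rfl⟩ := hab
  obtain ⟨v, rfl⟩ := hbc
  exact ⟨v * u, (mul_assoc _ _ _).symm⟩

lemma LDvd.mul_left {a b : M} (h : LDvd a b) (c : M) : LDvd (c * a) (c * b) := by
  obtain ⟨u, rfl⟩ := h
  exact ⟨u, (mul_assoc _ _ _).symm⟩

lemma LDvd.of_mul_left {a b c : M} (h : LDvd (c * a) (c * b)) : LDvd a b := by
  obtain ⟨u, hu⟩ := h
  exact ⟨u, mul_left_cancel (hu.trans (mul_assoc _ _ _))⟩

lemma IsStdParabolic.left_mem {P : Submonoid M} (hP : IsStdParabolic P) {a b : M}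
    (h : a * b ∈ P) : a ∈ P :=
  hP.factor_closed _ _ h (LDvd.isFactor ⟨b, rfl⟩)

lemma IsStdParabolic.right_mem {P : Submonoid M} (hP : IsStdParabolic P) {a b : M}
    (h : a * b ∈ P) : b ∈ P :=
  hP.factor_closed _ _ h (RDvd.isFactor ⟨a, rfl⟩)


namespace GarsideStruct

lemma isFactor_antisymm (G : GarsideStruct M) {a b : M} (hab : IsFactor a b) (hba : IsFactor b a) : a = b := by
  by_contra hne
  exact G.noetherian.asymmetric _ _ ⟨hab, hne⟩ ⟨hba, fun h => hne h.symm⟩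

lemma eq_one_of_mul_eq_one (G : GarsideStruct M) {a b : M} (h : a * b = 1) : a = 1 := by
  refine G.isFactor_antisymm (LDvd.isFactor ⟨b, h.symm⟩) (LDvd.isFactor ⟨a, (one_mul a).symm⟩)

lemma exists_eq_mul_of_not_isAtom (G : GarsideStruct M) {x : M} (hx : x ≠ 1) (hna : ¬ IsAtom' x) :
    ∃ y z, x = y * z ∧ y ≠ 1 ∧ z ≠ 1 := by
  have : ∃ b, IsFactor b x ∧ b ≠ 1 ∧ b ≠ x := by
    by_contra! hcon
    refine hna ⟨hx, fun b hb => ?_⟩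
    by_cases h : b = 1
    · exact Or.inl h
    · exact Or.inr (hcon b hb h)
  obtain ⟨b, hb, hb1, hbx⟩ := this
  obtain ⟨c, d, rfl⟩ := hb.exists_eq
  by_cases hc : c = 1
  · subst hc
    refine ⟨b, d, by rw [one_mul], hb1, ?_⟩
    rintro rfl
    exact hbx (by simp)
  · exact ⟨c, b * d, mul_assoc _ _ _, hc, fun h => hb1 (G.eq_one_of_mul_eq_one h)⟩

lemma mem_of_atoms_mem (G : GarsideStruct M) (N : Submonoid M) (x : M)
    (h : ∀ a, IsAtom' a → IsFactor a x → a ∈ N) : x ∈ N := by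
  induction x using G.noetherian.induction with
  | _ x ih =>
    by_cases hx : x = 1
    · exact hx ▸ N.one_mem
    by_cases ha : IsAtom' x
    · exact h x ha (LDvd.isFactor ⟨1, (mul_one x).symm⟩)
    obtain ⟨y, z, rfl, hy, hz⟩ := G.exists_eq_mul_of_not_isAtom hx ha
    have hyf : IsFactor y (y * z) := LDvd.isFactor ⟨z, rfl⟩
    have hzf : IsFactor z (y * z) := RDvd.isFactor ⟨y, rfl⟩
    exact N.mul_mem
      (ih y ⟨hyf, fun e => hz (by simpa using e)⟩ fun a ha hay => h a ha (hay.trans hyf))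
      (ih z ⟨hzf, fun e => hy (by simpa using e)⟩ fun a ha haz => h a ha (haz.trans hzf))

lemma exists_atom_ldvd (G : GarsideStruct M) {x : M} (hx : x ≠ 1) : ∃ a, IsAtom' a ∧ LDvd a x := by
  induction x using G.noetherian.induction with
  | _ x ih =>
    by_cases ha : IsAtom' x
    · exact ⟨x, ha, 1, (mul_one x).symm⟩
    obtain ⟨y, z, rfl, hy, hz⟩ := G.exists_eq_mul_of_not_isAtom hx ha
    have hyz : LDvd y (y * z) := ⟨z, rfl⟩
    obtain ⟨a, ha, hay⟩ := ih y ⟨hyz.isFactor, fun e => hz (by simpa using e)⟩ hy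
    exact ⟨a, ha, hay.trans hyz⟩

lemma atom_ldvd_delta (G : GarsideStruct M) {a : M} (ha : IsAtom' a) : LDvd a G.Δ := by
  have hmem : a ∈ Submonoid.closure {a : M | LDvd a G.Δ} := by
    rw [G.delta_generates]; trivial
  induction hmem using Submonoid.closure_induction with
  | mem x hx => exact hx
  | one => exact absurd rfl ha.1
  | mul x y _ _ ihx ihy =>
    rcases ha.2 x (LDvd.isFactor ⟨y, rfl⟩) with h | h
    · subst h
      rw [one_mul] at ha ⊢
      exact ihy ha
    · rw [← h] at ha ⊢
      exact ihx ha

/-- An intersection of standard parabolic submonoids is standard parabolic. -/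
lemma isStdParabolic_sInf (G : GarsideStruct M) (F : Set (Submonoid M)) (hF : ∀ Q ∈ F, IsStdParabolic Q) :
    IsStdParabolic (sInf F) where
  factor_closed a b hb hab := by
    rw [Submonoid.mem_sInf] at hb ⊢
    exact fun Q hQ => (hF Q hQ).factor_closed a b (hb Q hQ) hab
  exists_left_head g := by
    obtain ⟨x, ⟨h, hh, rfl⟩, hmin⟩ := G.noetherian.has_min
      {x | ∃ h ∈ sInf F, g = h * x} ⟨g, 1, one_mem _, (one_mul g).symm⟩
    refine ⟨h, hh, ⟨x, rfl⟩, fun h' hh' hd => ?_⟩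
    have hmem : G.rlcm h h' ∈ sInf F := by
      rw [Submonoid.mem_sInf] at hh hh' ⊢
      intro Q hQ
      obtain ⟨H, hHQ, -, hmax⟩ := (hF Q hQ).exists_left_head (h * x)
      exact (hF Q hQ).factor_closed _ _ hHQ
        (G.rlcm_least _ _ _ (hmax h (hh Q hQ) ⟨x, rfl⟩) (hmax h' (hh' Q hQ) hd)).isFactor
    obtain ⟨y, hy⟩ := G.rlcm_least _ _ _ ⟨x, rfl⟩ hd
    obtain ⟨k, hk⟩ := G.ldvd_rlcm_left h h'
    have hxy : x = k * y := mul_left_cancel (a := h) (by rw [hy, hk, mul_assoc])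
    have hyx : y = x := by
      by_contra hne
      exact hmin y ⟨_, hmem, hy⟩ ⟨RDvd.isFactor ⟨k, hxy⟩, hne⟩
    have hk1 : k = 1 := by
      rw [hyx] at hxy
      simpa using hxy.symm
    have := G.ldvd_rlcm_right h h'
    rwa [hk, hk1, mul_one] at this
  exists_right_head g := by
    obtain ⟨x, ⟨h, hh, rfl⟩, hmin⟩ := G.noetherian.has_min
      {x | ∃ h ∈ sInf F, g = x * h} ⟨g, 1, one_mem _, (mul_one g).symm⟩
    refine ⟨h, hh, ⟨x, rfl⟩, fun h' hh' hd => ?_⟩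
    have hmem : G.llcm h h' ∈ sInf F := by
      rw [Submonoid.mem_sInf] at hh hh' ⊢
      intro Q hQ
      obtain ⟨H, hHQ, -, hmax⟩ := (hF Q hQ).exists_right_head (x * h)
      exact (hF Q hQ).factor_closed _ _ hHQ
        (G.llcm_least _ _ _ (hmax h (hh Q hQ) ⟨x, rfl⟩) (hmax h' (hh' Q hQ) hd)).isFactor
    obtain ⟨y, hy⟩ := G.llcm_least _ _ _ ⟨x, rfl⟩ hd
    obtain ⟨k, hk⟩ := G.rdvd_llcm_left h h'
    have hxy : x = y * k := mul_right_cancel (b := h) (by rw [hy, hk, mul_assoc])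
    have hyx : y = x := by
      by_contra hne
      exact hmin y ⟨_, hmem, hy⟩ ⟨LDvd.isFactor ⟨k, hxy⟩, hne⟩
    have hk1 : k = 1 := by
      rw [hyx] at hxy
      simpa using hxy.symm
    have := G.rdvd_llcm_right h h'
    rwa [hk, hk1, one_mul] at this

lemma exists_isSmallestParabolicContaining (G : GarsideStruct M) (S₁ : Set M) :
    ∃ P₁ : Submonoid M, IsSmallestParabolicContaining S₁ P₁ := by
  refine ⟨sInf {Q | IsStdParabolic Q ∧ S₁ ⊆ (Q : Set M)},
    G.isStdParabolic_sInf _ fun Q hQ => hQ.1, fun s hs => ?_, fun Q hQ hS => sInf_le ⟨hQ, hS⟩⟩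
  rw [SetLike.mem_coe, Submonoid.mem_sInf]
  exact fun Q hQ => hQ.2 hs

variable {G : GarsideStruct M} {P : Submonoid M} {D : M}

/-- The left head of `Δ` is also its right head. -/
lemma isRightHead_of_isLeftHead (hP : IsStdParabolic P)
    (hD : IsLeftHead (P : Set M) G.Δ D) : IsRightHead (P : Set M) G.Δ D := by
  obtain ⟨h, hh, hd, hmax⟩ := hP.exists_right_head G.Δ
  have h1 := hmax D hD.1 ((G.delta_balanced D).1 hD.2.1)
  have h2 := hD.2.2 h hh ((G.delta_balanced h).2 hd)
  obtain rfl := G.isFactor_antisymm h1.isFactor h2.isFactor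
  exact ⟨hh, hd, hmax⟩

lemma rdvd_head_iff (hP : IsStdParabolic P) (hD : IsLeftHead (P : Set M) G.Δ D) (a : M) :
    RDvd a D ↔ LDvd a D := by
  have hD' := isRightHead_of_isLeftHead hP hD
  constructor <;> intro h
  · exact hD.2.2 a (hP.factor_closed _ _ hD.1 h.isFactor)
      ((G.delta_balanced a).2 (h.trans hD'.2.1))
  · exact hD'.2.2 a (hP.factor_closed _ _ hD.1 h.isFactor)
      ((G.delta_balanced a).1 (h.trans hD.2.1))

lemma atom_ldvd_head (hD : IsLeftHead (P : Set M) G.Δ D) {a : M} (haP : a ∈ P)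
    (ha : IsAtom' a) : LDvd a D :=
  hD.2.2 a haP (G.atom_ldvd_delta ha)

lemma exists_mul_head_eq (hP : IsStdParabolic P) (hD : IsLeftHead (P : Set M) G.Δ D)
    {p : M} (hp : p ∈ P) : ∃ q ∈ P, p * D = D * q := by
  let N : Submonoid M :=
    { carrier := {p | ∃ q ∈ P, p * D = D * q}
      one_mem' := ⟨1, one_mem _, by simp⟩
      mul_mem' := by
        rintro a b ⟨c, hc, hac⟩ ⟨d, hd, hbd⟩
        exact ⟨c * d, mul_mem hc hd, by rw [mul_assoc, hbd, ← mul_assoc, hac, mul_assoc]⟩ }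
  refine G.mem_of_atoms_mem N p fun a ha hap => ?_
  obtain ⟨b, hb⟩ := atom_ldvd_head hD (hP.factor_closed _ _ hp hap) ha
  obtain ⟨c, hc⟩ := (rdvd_head_iff hP hD b).1 ⟨a, hb⟩
  refine ⟨c, hP.right_mem (hc ▸ hD.1), ?_⟩
  calc a * D = a * (b * c) := by rw [← hc]
    _ = D * c := by rw [← mul_assoc, ← hb]

lemma exists_eq_head_mul (hP : IsStdParabolic P) (hD : IsLeftHead (P : Set M) G.Δ D)
    {q : M} (hq : q ∈ P) : ∃ p ∈ P, p * D = D * q := by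
  let N : Submonoid M :=
    { carrier := {q | ∃ p ∈ P, p * D = D * q}
      one_mem' := ⟨1, one_mem _, by simp⟩
      mul_mem' := by
        rintro a b ⟨c, hc, hac⟩ ⟨d, hd, hbd⟩
        exact ⟨c * d, mul_mem hc hd, by rw [mul_assoc, hbd, ← mul_assoc, hac, mul_assoc]⟩ }
  refine G.mem_of_atoms_mem N q fun a ha haq => ?_
  obtain ⟨b, hb⟩ := (rdvd_head_iff hP hD a).2
    (atom_ldvd_head hD (hP.factor_closed _ _ hq haq) ha)
  obtain ⟨c, hc⟩ := (rdvd_head_iff hP hD b).2 ⟨a, hb⟩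
  refine ⟨c, hP.left_mem (hc ▸ hD.1), ?_⟩
  calc c * D = c * (b * a) := by rw [← hb]
    _ = D * a := by rw [← mul_assoc, ← hc]

lemma exists_mul_head_pow_eq (hP : IsStdParabolic P) (hD : IsLeftHead (P : Set M) G.Δ D)
    (m : ℕ) {p : M} (hp : p ∈ P) : ∃ q ∈ P, p * D ^ m = D ^ m * q := by
  induction m generalizing p with
  | zero => exact ⟨p, hp, by simp⟩
  | succ m ih =>
    obtain ⟨q, hq, h1⟩ := ih hp
    obtain ⟨r, hr, h2⟩ := exists_mul_head_eq hP hD hq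
    exact ⟨r, hr, by rw [pow_succ, ← mul_assoc, h1, mul_assoc, h2, mul_assoc]⟩

lemma exists_eq_head_pow_mul (hP : IsStdParabolic P) (hD : IsLeftHead (P : Set M) G.Δ D)
    (m : ℕ) {q : M} (hq : q ∈ P) : ∃ p ∈ P, p * D ^ m = D ^ m * q := by
  induction m generalizing q with
  | zero => exact ⟨q, hq, by simp⟩
  | succ m ih =>
    obtain ⟨r, hr, h1⟩ := exists_eq_head_mul hP hD hq
    obtain ⟨p, hp, h2⟩ := ih hr
    exact ⟨p, hp, by rw [pow_succ, ← mul_assoc, h2, mul_assoc, h1, mul_assoc]⟩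

lemma exists_mul_eq_head_pow (hP : IsStdParabolic P) (hD : IsLeftHead (P : Set M) G.Δ D)
    {p : M} (hp : p ∈ P) : ∃ m : ℕ, ∃ y ∈ P, y * p = D ^ m := by
  let N : Submonoid M :=
    { carrier := {p | ∃ m : ℕ, ∃ y ∈ P, y * p = D ^ m}
      one_mem' := ⟨0, 1, one_mem _, by simp⟩
      mul_mem' := by
        rintro a b ⟨m, y, hy, hya⟩ ⟨n, z, hz, hzb⟩
        obtain ⟨w, hw, hwz⟩ := exists_eq_head_pow_mul hP hD m hz
        refine ⟨m + n, w * y, mul_mem hw hy, ?_⟩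
        calc w * y * (a * b) = w * (y * a) * b := by simp only [mul_assoc]
          _ = D ^ (m + n) := by rw [hya, hwz, mul_assoc, hzb, pow_add] }
  refine G.mem_of_atoms_mem N p fun a ha hap => ?_
  obtain ⟨b, hb⟩ := (rdvd_head_iff hP hD a).2
    (atom_ldvd_head hD (hP.factor_closed _ _ hp hap) ha)
  exact ⟨1, b, hP.left_mem (hb ▸ hD.1), by rw [pow_one, ← hb]⟩

lemma exists_eq_mul_head_pow (hP : IsStdParabolic P) (hD : IsLeftHead (P : Set M) G.Δ D)
    {p : M} (hp : p ∈ P) : ∃ m : ℕ, ∃ y ∈ P, p * y = D ^ m := by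
  obtain ⟨m, y, hy, hyp⟩ := exists_mul_eq_head_pow hP hD hp
  obtain ⟨z, hz, hyz⟩ := exists_mul_head_pow_eq hP hD m hy
  refine ⟨m, z, hz, mul_left_cancel (a := y) ?_⟩
  rw [← mul_assoc, hyp, hyz]

end GarsideStruct

section Conjugation

/-- The submonoid of the elements `q` such that `p * E = E * q` for some `p ∈ P`. -/
def conjSubmonoid (P : Submonoid M) (E : M) : Submonoid M where
  carrier := {q | ∃ p ∈ P, p * E = E * q}
  one_mem' := ⟨1, one_mem _, by simp⟩
  mul_mem' := by
    rintro a b ⟨c, hc, hac⟩ ⟨d, hd, hbd⟩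
    exact ⟨c * d, mul_mem hc hd, by rw [mul_assoc, hbd, ← mul_assoc, hac, mul_assoc]⟩

variable {G : GarsideStruct M} {P R : Submonoid M} {D E : M}

lemma conj_mem (hR : IsStdParabolic R) (hE : IsLeftHead (R : Set M) G.Δ E)
    {p q : M} (hp : p ∈ R) (h : p * E = E * q) : q ∈ R := by
  obtain ⟨q', hq', h'⟩ := GarsideStruct.exists_mul_head_eq hR hE hp
  rwa [mul_left_cancel (h.symm.trans h')]

lemma ldvd_conj_iff (hR : IsStdParabolic R) (hE : IsLeftHead (R : Set M) G.Δ E)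
    {a b a' b' : M} (hb : b ∈ R) (haa : a * E = E * a') (hbb : b * E = E * b') :
    LDvd a b ↔ LDvd a' b' := by
  constructor
  · rintro ⟨c, rfl⟩
    obtain ⟨d, -, hd⟩ := GarsideStruct.exists_mul_head_eq hR hE (hR.right_mem hb)
    refine ⟨d, mul_left_cancel (a := E) ?_⟩
    rw [← hbb, mul_assoc, hd, ← mul_assoc, haa, mul_assoc]
  · rintro ⟨c, rfl⟩
    obtain ⟨d, -, hd⟩ := GarsideStruct.exists_eq_head_mul hR hE
      (hR.right_mem (conj_mem hR hE hb hbb))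
    refine ⟨d, mul_right_cancel (b := E) ?_⟩
    rw [hbb, mul_assoc, hd, ← mul_assoc, ← mul_assoc, haa]

lemma rdvd_conj_iff (hR : IsStdParabolic R) (hE : IsLeftHead (R : Set M) G.Δ E)
    {a b a' b' : M} (hb : b ∈ R) (haa : a * E = E * a') (hbb : b * E = E * b') :
    RDvd a b ↔ RDvd a' b' := by
  constructor
  · rintro ⟨c, rfl⟩
    obtain ⟨d, -, hd⟩ := GarsideStruct.exists_mul_head_eq hR hE (hR.left_mem hb)
    refine ⟨d, mul_left_cancel (a := E) ?_⟩
    rw [← hbb, mul_assoc, haa, ← mul_assoc, hd, mul_assoc]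
  · rintro ⟨c, rfl⟩
    obtain ⟨d, -, hd⟩ := GarsideStruct.exists_eq_head_mul hR hE
      (hR.left_mem (conj_mem hR hE hb hbb))
    refine ⟨d, mul_right_cancel (b := E) ?_⟩
    rw [hbb, mul_assoc, haa, ← mul_assoc, ← mul_assoc, hd]

lemma isStdParabolic_conjSubmonoid (hR : IsStdParabolic R)
    (hE : IsLeftHead (R : Set M) G.Δ E) (hP : IsStdParabolic P) (hPR : P ≤ R) :
    IsStdParabolic (conjSubmonoid P E) where
  factor_closed := by
    rintro a q ⟨p, hp, hpq⟩ haq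
    obtain ⟨c, ⟨d, rfl⟩, hcq⟩ := haq
    have hqR := conj_mem hR hE (hPR hp) hpq
    have hcR := hR.factor_closed _ _ hqR hcq.isFactor
    obtain ⟨c', hc', hcc⟩ := GarsideStruct.exists_eq_head_mul hR hE hcR
    obtain ⟨a', ha', haa⟩ := GarsideStruct.exists_eq_head_mul hR hE (hR.left_mem hcR)
    have h1 := (rdvd_conj_iff hR hE (hPR hp) hcc hpq).2 hcq
    have h2 := (ldvd_conj_iff hR hE hc' haa hcc).2 ⟨d, rfl⟩
    exact ⟨a', hP.factor_closed _ _ hp ⟨c', h2, h1⟩, haa⟩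
  exists_left_head g := by
    obtain ⟨H, hH, hHg, hHmax⟩ := hR.exists_left_head g
    obtain ⟨k, hk, hkH⟩ := GarsideStruct.exists_eq_head_mul hR hE hH
    obtain ⟨l, hl, hlk, hlmax⟩ := hP.exists_left_head k
    obtain ⟨m, -, hlm⟩ := GarsideStruct.exists_mul_head_eq hR hE (hPR hl)
    refine ⟨m, ⟨l, hl, hlm⟩, ((ldvd_conj_iff hR hE hk hlm hkH).1 hlk).trans hHg, ?_⟩
    rintro q ⟨p, hp, hpq⟩ hqg
    have hqH := hHmax q (conj_mem hR hE (hPR hp) hpq) hqg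
    exact (ldvd_conj_iff hR hE (hPR hl) hpq hlm).1
      (hlmax p hp ((ldvd_conj_iff hR hE hk hpq hkH).2 hqH))
  exists_right_head g := by
    obtain ⟨H, hH, hHg, hHmax⟩ := hR.exists_right_head g
    obtain ⟨k, hk, hkH⟩ := GarsideStruct.exists_eq_head_mul hR hE hH
    obtain ⟨l, hl, hlk, hlmax⟩ := hP.exists_right_head k
    obtain ⟨m, -, hlm⟩ := GarsideStruct.exists_mul_head_eq hR hE (hPR hl)
    refine ⟨m, ⟨l, hl, hlm⟩, ((rdvd_conj_iff hR hE hk hlm hkH).1 hlk).trans hHg, ?_⟩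
    rintro q ⟨p, hp, hpq⟩ hqg
    have hqH := hHmax q (conj_mem hR hE (hPR hp) hpq) hqg
    exact (rdvd_conj_iff hR hE (hPR hl) hpq hlm).1
      (hlmax p hp ((rdvd_conj_iff hR hE hk hpq hkH).2 hqH))

lemma isLeftHead_conjSubmonoid (hR : IsStdParabolic R)
    (hE : IsLeftHead (R : Set M) G.Δ E) (hPR : P ≤ R)
    (hD : IsLeftHead (P : Set M) G.Δ D) {D' : M} (hDD : D * E = E * D') :
    IsLeftHead (conjSubmonoid P E : Set M) G.Δ D' := by
  have hDE : LDvd D E := hE.2.2 D (hPR hD.1) hD.2.1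
  refine ⟨⟨D, hD.1, hDD⟩, ((ldvd_conj_iff hR hE hE.1 hDD rfl).1 hDE).trans hE.2.1, ?_⟩
  rintro q ⟨p, hp, hpq⟩ hqΔ
  have hqE := hE.2.2 q (conj_mem hR hE (hPR hp) hpq) hqΔ
  exact (ldvd_conj_iff hR hE (hPR hD.1) hpq hDD).1
    (hD.2.2 p hp (((ldvd_conj_iff hR hE hE.1 hpq rfl).2 hqE).trans hE.2.1))

/-- If `Δ_R = Δ_P * v`, then conjugating `P` by `v` amounts to conjugating by `Δ_R`. -/
lemma exists_mul_quotient_eq (hR : IsStdParabolic R) (hE : IsLeftHead (R : Set M) G.Δ E)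
    (hP : IsStdParabolic P) (hPR : P ≤ R) (hD : IsLeftHead (P : Set M) G.Δ D)
    {v : M} (hv : E = D * v) {p : M} (hp : p ∈ P) :
    ∃ q ∈ conjSubmonoid P E, p * v = v * q := by
  obtain ⟨r, hr, hrp⟩ := GarsideStruct.exists_eq_head_mul hP hD hp
  obtain ⟨q, -, hrq⟩ := GarsideStruct.exists_mul_head_eq hR hE (hPR hr)
  refine ⟨q, ⟨r, hr, hrq⟩, mul_left_cancel (a := D) ?_⟩
  rw [← mul_assoc, ← hrp, mul_assoc, ← hv, hrq, hv, mul_assoc]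

lemma exists_eq_quotient_mul (hP : IsStdParabolic P) (hD : IsLeftHead (P : Set M) G.Δ D)
    {v : M} (hv : E = D * v) {q : M} (hq : q ∈ conjSubmonoid P E) :
    ∃ p ∈ P, p * v = v * q := by
  obtain ⟨r, hr, hrq⟩ := hq
  obtain ⟨p, hp, hrp⟩ := GarsideStruct.exists_mul_head_eq hP hD hr
  refine ⟨p, hp, mul_left_cancel (a := D) ?_⟩
  rw [← mul_assoc, ← hrp, mul_assoc, ← hv, hrq, hv, mul_assoc]

lemma head_mul_quotient {v : M} (hv : E = D * v) {D' : M} (hDD : D * E = E * D') :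
    D * v = v * D' := by
  refine mul_left_cancel (a := D) ?_
  rw [← hv, hDD, hv, mul_assoc]

/-- The right lcm of `Δ_P` and `v` is `Δ_P * v` when `Δ_R = Δ_P * v`. -/
lemma quotient_ldvd_of_ldvd_head_mul (hR : IsStdParabolic R)
    (hE : IsLeftHead (R : Set M) G.Δ E) (hP : IsStdParabolic P) (hPR : P ≤ R)
    (hD : IsLeftHead (P : Set M) G.Δ D) {v : M} (hv : E = D * v) {h : M}
    (hvh : LDvd v (D * h)) : LDvd v h := by
  obtain ⟨D', -, hDD⟩ := GarsideStruct.exists_mul_head_eq hR hE (hPR hD.1)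
  have hQ := isStdParabolic_conjSubmonoid hR hE hP hPR
  have hDv := head_mul_quotient hv hDD
  obtain ⟨l₁, hl₁⟩ := G.ldvd_rlcm_left D v
  obtain ⟨l₂, hl₂⟩ := G.ldvd_rlcm_right D v
  obtain ⟨u, hu⟩ := G.rlcm_least D v E ⟨v, hv⟩ ⟨D', hv.trans hDv⟩
  have hvu : v = l₁ * u := mul_left_cancel (a := D) (by rw [← hv, hu, hl₁, mul_assoc])
  have hD'u : D' = l₂ * u :=
    mul_left_cancel (a := v) (by rw [← hDv, ← hv, hu, hl₂, mul_assoc])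
  have hD'Q : D' ∈ conjSubmonoid P E := ⟨D, hD.1, hDD⟩
  obtain ⟨p, hp, hpu⟩ := hQ.right_mem (hD'u ▸ hD'Q)
  have hpD : p * D * E = E * (u * D') := by
    rw [mul_assoc, hDD, ← mul_assoc, hpu, mul_assoc]
  have huE : RDvd (u * D') E := ⟨l₁, by rw [← mul_assoc, ← hvu, ← hDv, hv]⟩
  have hpDE : LDvd (p * D) E :=
    (GarsideStruct.rdvd_head_iff hR hE _).1 ((rdvd_conj_iff hR hE hE.1 hpD rfl).2 huE)
  have hpDD : LDvd (p * D) D := hD.2.2 _ (mul_mem hp hD.1) (hpDE.trans hE.2.1)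
  have hp1 : p = 1 := by
    have := G.isFactor_antisymm hpDD.isFactor (RDvd.isFactor ⟨p, rfl⟩)
    simpa using this
  have hu1 : u = 1 := by
    rw [hp1, one_mul] at hpu
    simpa using hpu.symm
  have hlcm := G.rlcm_least D v (D * h) ⟨h, rfl⟩ hvh
  rw [hu1, mul_one] at hu
  rw [← hu, hv] at hlcm
  exact hlcm.of_mul_left

lemma quotient_ldvd_of_ldvd_head_pow_mul (hR : IsStdParabolic R)
    (hE : IsLeftHead (R : Set M) G.Δ E) (hP : IsStdParabolic P) (hPR : P ≤ R)
    (hD : IsLeftHead (P : Set M) G.Δ D) {v : M} (hv : E = D * v) {h : M} (m : ℕ)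
    (hvh : LDvd v (D ^ m * h)) : LDvd v h := by
  induction m with
  | zero => simpa using hvh
  | succ m ih =>
    rw [pow_succ', mul_assoc] at hvh
    exact ih (quotient_ldvd_of_ldvd_head_mul hR hE hP hPR hD hv hvh)

end Conjugation

section Ribbon

variable {G : GarsideStruct M}

/-- A `P`-reduced `g ≠ 1` conjugating into `M` some `b ∈ P` divisible by `Δ_P` is
left-divisible by some `v ≠ 1` such that `Δ_P * v` is the Garside element of a standard
parabolic submonoid containing `P`. -/
lemma exists_quotient_ldvd (hA : Assumption1 G) {P : Submonoid M} (hP : IsStdParabolic P)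
    {D : M} (hD : IsLeftHead (P : Set M) G.Δ D) {b g : M} (hb : b ∈ P) (hDb : LDvd D b)
    (hg : PReduced (P : Set M) g) (hg1 : g ≠ 1) (hconj : LDvd g (b * g)) :
    ∃ (R : Submonoid M) (E v : M), IsStdParabolic R ∧ IsLeftHead (R : Set M) G.Δ E ∧
      P ≤ R ∧ E = D * v ∧ v ≠ 1 ∧ LDvd v g := by
  obtain ⟨r, hr, hrg⟩ := G.exists_atom_ldvd hg1
  obtain ⟨R, hRS⟩ := G.exists_isSmallestParabolicContaining ({a | a ∈ P ∧ IsAtom' a} ∪ {r})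
  have hR := hRS.1
  have hPR : P ≤ R := fun p hp => G.mem_of_atoms_mem R p fun a ha hap =>
    hRS.2.1 (Or.inl ⟨hP.factor_closed _ _ hp hap, ha⟩)
  obtain ⟨E, hE⟩ := hR.exists_left_head G.Δ
  have hlcm := hA _ (by
    rintro s (hs | rfl)
    · exact hs.2
    · exact hr) R hRS E hE
  obtain ⟨v, hv⟩ := hE.2.2 D (hPR hD.1) hD.2.1
  have hv1 : v ≠ 1 := by
    rintro rfl
    have hrE : LDvd r E := hlcm.1 r (Or.inr rfl)
    rw [hv, mul_one] at hrE
    exact hr.1 (hg r (hP.factor_closed _ _ hD.1 hrE.isFactor) hrg)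
  refine ⟨R, E, v, hR, hE, hPR, hv, hv1, ?_⟩
  have hEbg : LDvd E (b * g) := by
    refine hlcm.2 _ ?_
    rintro s (hs | rfl)
    · exact (GarsideStruct.atom_ldvd_head hD hs.1 hs.2).trans (hDb.trans ⟨g, rfl⟩)
    · exact hrg.trans hconj
  have hvp : ∀ p ∈ P, LDvd v (p * v) := fun p hp => by
    obtain ⟨q, -, hq⟩ := exists_mul_quotient_eq hR hE hP hPR hD hv hp
    exact ⟨q, hq⟩
  have hvbg : LDvd v (b * g) := (hvp D hD.1).trans (hv ▸ hEbg)
  obtain ⟨m, y, hy, hyb⟩ := GarsideStruct.exists_mul_eq_head_pow hP hD hb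
  refine quotient_ldvd_of_ldvd_head_pow_mul hR hE hP hPR hD hv m ?_
  have := (hvp y hy).trans (hvbg.mul_left y)
  rwa [← mul_assoc, hyb] at this

lemma conjSetDef_of_pReduced (hA : Assumption1 G) (g : M) {P : Submonoid M}
    (hP : IsStdParabolic P) {D : M} (hD : IsLeftHead (P : Set M) G.Δ D) {b : M} (hb : b ∈ P)
    (hDb : LDvd D b) (hg : PReduced (P : Set M) g) (hconj : LDvd g (b * g)) :
    ConjSetDef (P : Set M) g := by
  induction g using G.noetherian.induction generalizing P D b with
  | _ g ih =>
    by_cases hg1 : g = 1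
    · exact fun p _ => ⟨p, by simp [hg1]⟩
    obtain ⟨R, E, v, hR, hE, hPR, hv, hv1, g', rfl⟩ :=
      exists_quotient_ldvd hA hP hD hb hDb hg hg1 hconj
    obtain ⟨D', -, hDD⟩ := GarsideStruct.exists_mul_head_eq hR hE (hPR hD.1)
    have hconjv : ∀ p ∈ P, ∃ q ∈ conjSubmonoid P E, p * v = v * q := fun p hp =>
      exists_mul_quotient_eq hR hE hP hPR hD hv hp
    obtain ⟨c, hc, hbc⟩ := hconjv b hb
    have hD'c : LDvd D' c := by
      obtain ⟨x, rfl⟩ := hDb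
      obtain ⟨y, -, hxy⟩ := hconjv x (hP.right_mem hb)
      refine ⟨y, mul_left_cancel (a := v) ?_⟩
      rw [← hbc, mul_assoc, hxy, ← mul_assoc, head_mul_quotient hv hDD, mul_assoc]
    have hg' : PReduced (conjSubmonoid P E : Set M) g' := by
      intro q hq hqg
      obtain ⟨p, hp, hpq⟩ := exists_eq_quotient_mul hP hD hv hq
      have hp1 : p = 1 := hg p hp (LDvd.trans ⟨v, rfl⟩ (hpq ▸ hqg.mul_left v))
      rw [hp1, one_mul] at hpq
      simpa using hpq.symm
    have hconj' : LDvd g' (c * g') := by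
      rw [← mul_assoc, hbc, mul_assoc] at hconj
      exact hconj.of_mul_left
    have key := ih g' ⟨RDvd.isFactor ⟨v, rfl⟩, fun e => hv1 (by simpa using e)⟩
      (isStdParabolic_conjSubmonoid hR hE hP hPR)
      (isLeftHead_conjSubmonoid hR hE hPR hD hDD) hc hD'c hg' hconj'
    intro p hp
    obtain ⟨q, hq, hpq⟩ := hconjv p hp
    rw [← mul_assoc, hpq, mul_assoc]
    exact (key q hq).mul_left v

lemma LDvd.pow_mul {b g : M} (h : LDvd g (b * g)) (n : ℕ) : LDvd g (b ^ n * g) := by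
  induction n with
  | zero => exact ⟨1, by simp⟩
  | succ n ih =>
    rw [pow_succ', mul_assoc]
    exact h.trans (ih.mul_left b)

lemma head_pow_ldvd_pow {P : Submonoid M} (hP : IsStdParabolic P) {D : M}
    (hD : IsLeftHead (P : Set M) G.Δ D) {a : M} (ha : a ∈ P) (hDa : LDvd D a) (n : ℕ) :
    LDvd (D ^ n) (a ^ n) := by
  induction n with
  | zero => exact ⟨1, by simp⟩
  | succ n ih =>
    obtain ⟨y, hy⟩ := ih
    obtain ⟨x, hx⟩ := hDa
    obtain ⟨z, -, hz⟩ := GarsideStruct.exists_mul_head_pow_eq hP hD n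
      (hP.right_mem (hx ▸ ha))
    refine ⟨z * y, ?_⟩
    calc a ^ (n + 1) = D * x * (D ^ n * y) := by rw [pow_succ', hy, hx]
      _ = D * (x * D ^ n) * y := by simp only [mul_assoc]
      _ = D ^ (n + 1) * (z * y) := by rw [hz, pow_succ']; simp only [mul_assoc]

lemma ldvd_head_of_ldvd_mul {P : Submonoid M} (hP : IsStdParabolic P) {b g h : M}
    (hb : b ∈ P) (hh : IsLeftHead (P : Set M) g h) {p : M} (hp : p ∈ P)
    (hpg : LDvd p (b * g)) : LDvd p (b * h) := by
  obtain ⟨H, hH, hHg, hmax⟩ := hP.exists_left_head (b * g)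
  obtain ⟨q, rfl⟩ := hmax b hb ⟨g, rfl⟩
  exact (hmax p hp hpg).trans ((hh.2.2 q (hP.right_mem hH) hHg.of_mul_left).mul_left b)

lemma pReduced_tail (G : GarsideStruct M) {P : Submonoid M} {h t : M}
    (hh : IsLeftHead (P : Set M) (h * t) h) : PReduced (P : Set M) t := by
  rintro p hp ⟨x, rfl⟩
  obtain ⟨y, hy⟩ := hh.2.2 (h * p) (mul_mem hh.1 hp) ⟨x, by simp only [mul_assoc]⟩
  refine G.eq_one_of_mul_eq_one (b := y) (mul_left_cancel (a := h) ?_)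
  rw [← mul_assoc, ← hy, mul_one]

end Ribbon

/-- if `b ∈ P`, `b ^ g` is defined and `Δ_P` left-divides
`b ^ i` for some `i > 0`, then the `P`-tail `T_P(g)` is a `P`-ribbon. -/
theorem statement15 (G : GarsideStruct M) (hA : Assumption1 G)
    (P : Submonoid M) (hP : IsStdParabolic P)
    (b : M) (hb : b ∈ P) (g : M) (hconj : LDvd g (b * g))
    (dP : M) (hdP : IsLeftHead (P : Set M) G.Δ dP)
    (i : ℕ) (hi : 0 < i) (hdvd : LDvd dP (b ^ i))
    (hd t : M) (hhd : IsLeftHead (P : Set M) g hd) (ht : g = hd * t) :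
    IsRibbon (P : Set M) t := by
  subst ht
  have hbn : ∀ n, b ^ n ∈ P := fun n => pow_mem hb n
  obtain ⟨k, y, hy, hyk⟩ := GarsideStruct.exists_eq_mul_head_pow hP hdP hhd.1
  obtain ⟨x, hx⟩ := head_pow_ldvd_pow hP hdP (hbn i) hdvd (k + 1)
  rw [← pow_mul] at hx
  have hg := hconj.pow_mul (i * (k + 1))
  obtain ⟨c, hc⟩ := ldvd_head_of_ldvd_mul hP (hbn _) hhd hhd.1 (hhd.2.1.trans hg)
  have hcP : c ∈ P := hP.right_mem (hc ▸ mul_mem (hbn _) hhd.1)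
  obtain ⟨z, -, hz⟩ := GarsideStruct.exists_mul_head_eq hP hdP hy
  have hdc : LDvd dP c := by
    refine ⟨z * x * hd, mul_left_cancel (a := hd) ?_⟩
    calc hd * c = hd * (y * dP) * x * hd := by
          rw [← hc, hx, pow_succ, ← hyk]; simp only [mul_assoc]
      _ = hd * (dP * (z * x * hd)) := by rw [hz]; simp only [mul_assoc]
  have hred := pReduced_tail G hhd
  rw [← mul_assoc, hc, mul_assoc] at hg
  exact ⟨hred, conjSetDef_of_pReduced hA t hP hdP hcP hdc hred hg.of_mul_left⟩

end GarsidePaper
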